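/- For every i ≥ 0, K_i is a submodule of H under the adjoint action: for all h ∈ H and k ∈ K_i, the element h_(1) k S(h_(2)) lies in K_i. -/

import Mathlib

open TensorProduct

section HopfHecke

variable (F H V : Type*) [Field F] [CharZero F] [Ring H] [HopfAlgebra F H]
  [AddCommGroup V] [Module F V] [Module H V] [IsScalarTower F H V]

/-- The "triangle" operation `h ▷ v := h • v − ε(h) • v`, as a bilinear map. -/
noncomputable def trb : H →ₗ[F] V →ₗ[F] V :=
  LinearMap.mk₂ F (fun h v => h • v - Coalgebra.counit (R := F) h • v)
    (fun h h' v => by simp [add_smul, map_add]; abel)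
    (fun c h v => by simp [smul_assoc, smul_sub, smul_smul])
    (fun h v v' => by simp [smul_add]; abel)
    (fun c h v => by simp [smul_comm c, smul_sub])

/-- The Sweedler-style element
`(h₍₁₎ ▷ v₁) ∧ ⋯ ∧ (h₍k₎ ▷ v_k) ⊗ h₍k₊₁₎ ∈ ΛV ⊗ H`, as a linear map in `h`. -/
noncomputable def sweedlerWedge : (k : ℕ) → (Fin k → V) →
    (H →ₗ[F] ExteriorAlgebra F V ⊗[F] H)
  | 0, _ => TensorProduct.mk F (ExteriorAlgebra F V) H 1
  | (k+1), vs =>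
      TensorProduct.lift
        (((LinearMap.llcomp F H (ExteriorAlgebra F V ⊗[F] H) (ExteriorAlgebra F V ⊗[F] H)).flip
            (sweedlerWedge k (fun i => vs i.succ))) ∘ₗ
          (LinearMap.rTensorHom (M := H)) ∘ₗ (LinearMap.mul F (ExteriorAlgebra F V)) ∘ₗ
          (ExteriorAlgebra.ι F) ∘ₗ ((trb F H V).flip (vs 0))) ∘ₗ
        (Coalgebra.comul (R := F))

/-- Applying the counit to the trailing tensor factor; composing this with
`sweedlerWedge (i+1) vs` gives `(h₍₁₎ ▷ v₁) ∧ ⋯ ∧ (h₍ᵢ₊₁₎ ▷ v_{i+1}) ∈ ΛV`. -/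
noncomputable def purify : ExteriorAlgebra F V ⊗[F] H →ₗ[F] ExteriorAlgebra F V :=
  (TensorProduct.rid F (ExteriorAlgebra F V)).toLinearMap ∘ₗ
    (LinearMap.lTensor (ExteriorAlgebra F V) (Coalgebra.counit (R := F)))

/-- The subspace `K'_i ⊆ H` of elements `h` with
`(h₍₁₎ ▷ v₁) ∧ ⋯ ∧ (h₍ᵢ₊₁₎ ▷ v_{i+1}) = 0` for all `v₁, …, v_{i+1} ∈ V`. -/
noncomputable def Kp (i : ℕ) : Submodule F H :=
  ⨅ vs : Fin (i+1) → V,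
    LinearMap.ker ((purify F H V) ∘ₗ (sweedlerWedge F H V (i+1) vs))

/-- The subspace `K_i := Δ⁻¹(K'_i ⊗ H) ⊆ H`. -/
noncomputable def K (i : ℕ) : Submodule F H :=
  Submodule.comap (Coalgebra.comul (R := F))
    (LinearMap.range (TensorProduct.map (Kp F H V i).subtype (LinearMap.id (M := H))))

end HopfHecke

/-- The adjoint action `h · k := h₍₁₎ k S(h₍₂₎)` of `H` on itself. -/
noncomputable def adj (F H : Type*) [Field F] [Ring H] [HopfAlgebra F H] (h k : H) : H :=
  TensorProduct.lift
    (((LinearMap.llcomp F H H H).flip (HopfAlgebra.antipode (R := F))) ∘ₗ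
      (LinearMap.mul F H) ∘ₗ (LinearMap.mulRight F k))
    (Coalgebra.comul (R := F) h)

open Coalgebra WithConv

section AdjointAction

variable {F H : Type*} [Field F] [Ring H] [HopfAlgebra F H]

/-- In a cocommutative Hopf algebra the antipode commutes with comultiplication. -/
theorem comul_comp_antipode [IsCocomm F H] :
    comul ∘ₗ HopfAlgebra.antipode F (A := H) =
      TensorProduct.map (HopfAlgebra.antipode F) (HopfAlgebra.antipode F) ∘ₗ comul := by
  apply toConv_injective
  refine (left_inv_eq_right_inv (a := toConv (comul (R := F) (A := H))) ?_
    LinearMap.comul_right_inv).symm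
  have hcomp := LinearMap.convMul_comp_coalgHom_distrib
    (toConv (TensorProduct.map (HopfAlgebra.antipode F (A := H)) (HopfAlgebra.antipode F (A := H))))
    (toConv (TensorProduct.map LinearMap.id LinearMap.id)) (comulCoalgHom F H)
  have hmul := TensorProduct.map_convMul_map (f := toConv (HopfAlgebra.antipode F (A := H)))
    (g := toConv (HopfAlgebra.antipode F (A := H)))
    (h := toConv LinearMap.id) (k := toConv LinearMap.id)
  rw [LinearMap.antipode_mul_id] at hmul
  apply WithConv.ext
  rw [TensorProduct.map_id] at hcomp
  refine hcomp.symm.trans ?_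
  rw [TensorProduct.map_id] at hmul
  rw [hmul]
  ext x
  have hone : ∀ z : H ⊗[F] H, TensorProduct.map (1 : WithConv (H →ₗ[F] H)).ofConv
      (1 : WithConv (H →ₗ[F] H)).ofConv z = algebraMap F (H ⊗[F] H) (counit z) := by
    intro z
    induction z with
    | zero => simp
    | add x y hx hy => simp only [map_add, hx, hy]
    | tmul x y => simp [Algebra.algebraMap_eq_smul_one, Algebra.TensorProduct.one_def,
        TensorProduct.smul_tmul', TensorProduct.tmul_smul, smul_smul]
  refine (hone _).trans ?_
  exact congrArg _ (LinearMap.congr_fun (comulCoalgHom F H).counit_comp x)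

/-- The antipode of a cocommutative Hopf algebra as a coalgebra morphism. -/
noncomputable def antipodeCoalgHom (F H : Type*) [Field F] [Ring H] [HopfAlgebra F H]
    [IsCocomm F H] : H →ₗc[F] H where
  __ := HopfAlgebra.antipode F (A := H)
  counit_comp := HopfAlgebra.counit_comp_antipode
  map_comp_comul := comul_comp_antipode.symm

/-- The adjoint action of a cocommutative Hopf algebra as a coalgebra morphism. -/
noncomputable def adjCoalgHom (F H : Type*) [Field F] [Ring H] [HopfAlgebra F H]
    [IsCocomm F H] : H ⊗[F] H →ₗc[F] H :=
  (Bialgebra.mulCoalgHom F H).comp <|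
    (CoalgHom.lTensor H ((Bialgebra.mulCoalgHom F H).comp <|
      (CoalgHom.lTensor H (antipodeCoalgHom F H)).comp
        (Bialgebra.TensorProduct.comm F H H).toBialgHom.toCoalgHom)).comp <|
    (Coalgebra.TensorProduct.assoc F F H H H : (H ⊗[F] H) ⊗[F] H →ₗc[F] H ⊗[F] (H ⊗[F] H)).comp <|
    CoalgHom.rTensor H (comulCoalgHom F H)

theorem adjCoalgHom_tmul [IsCocomm F H] (h k : H) : adjCoalgHom F H (h ⊗ₜ k) = adj F H h k := by
  have key : ∀ z : H ⊗[F] H,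
    Bialgebra.mulCoalgHom F H (CoalgHom.lTensor H ((Bialgebra.mulCoalgHom F H).comp <|
      (CoalgHom.lTensor H (antipodeCoalgHom F H)).comp
        (Bialgebra.TensorProduct.comm F H H).toBialgHom.toCoalgHom)
      (Coalgebra.TensorProduct.assoc F F H H H (z ⊗ₜ k))) =
       TensorProduct.lift
    (((LinearMap.llcomp F H H H).flip (HopfAlgebra.antipode (R := F))) ∘ₗ
      (LinearMap.mul F H) ∘ₗ (LinearMap.mulRight F k)) z := by
    intro z
    induction z with
    | zero => simp
    | add x y hx hy => simp only [TensorProduct.add_tmul, map_add, hx, hy]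
    | tmul x y =>
      simp only [TensorProduct.lift.tmul]
      exact (mul_assoc _ _ _).symm
  exact key (comul h)

end AdjointAction

section DiagonalAction

variable (F H V : Type*) [Field F] [CharZero F] [Ring H] [HopfAlgebra F H]
  [AddCommGroup V] [Module F V] [Module H V] [IsScalarTower F H V]

/-- The diagonal action of a cocommutative Hopf algebra on the exterior algebra of a module,
`v₁ ∧ ⋯ ∧ vₙ ↦ (h ↦ (h₍₁₎ v₁) ∧ ⋯ ∧ (h₍ₙ₎ vₙ))`, as an algebra morphism into the convolution
algebra. -/
noncomputable def diagAlgHom [IsCocomm F H] :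
    ExteriorAlgebra F V →ₐ[F] WithConv (H →ₗ[F] ExteriorAlgebra F V) :=
  ExteriorAlgebra.lift F
    ⟨(WithConv.linearEquiv F _).symm.toLinearMap ∘ₗ LinearMap.compRight F (ExteriorAlgebra.ι F) ∘ₗ
      (Algebra.lsmul F F V : H →ₐ[F] Module.End F V).toLinearMap.flip, by
      intro v
      ext h
      set f : H →ₗ[F] ExteriorAlgebra F V := ExteriorAlgebra.ι F ∘ₗ
        (Algebra.lsmul F F V : H →ₐ[F] Module.End F V).toLinearMap.flip v
      have hf : ∀ z : H ⊗[F] H, LinearMap.mul' F _ (TensorProduct.map f f z) =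
          - LinearMap.mul' F _ (TensorProduct.map f f (TensorProduct.comm F H H z)) := by
        intro z
        induction z with
        | zero => simp
        | add x y hx hy => simp only [map_add, hx, hy, neg_add]
        | tmul x y =>
          simp only [TensorProduct.map_tmul, LinearMap.mul'_apply, TensorProduct.comm_tmul]
          exact eq_neg_of_add_eq_zero_left (ExteriorAlgebra.ι_add_mul_swap (x • v) (y • v))
      have := hf (comul h)
      rw [comm_comul] at this
      have h2 : (2 : F) • LinearMap.mul' F _ (TensorProduct.map f f (comul h)) = 0 := by
        rw [two_smul]
        exact eq_neg_iff_add_eq_zero.mp this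
      exact (smul_eq_zero.mp h2).resolve_left two_ne_zero⟩

/-- The diagonal action on the exterior algebra, `h ⊗ x ↦ h x`. -/
noncomputable def diagAct [IsCocomm F H] :
    H ⊗[F] ExteriorAlgebra F V →ₗ[F] ExteriorAlgebra F V :=
  TensorProduct.lift
    ((WithConv.linearEquiv F _).toLinearMap ∘ₗ (diagAlgHom F H V).toLinearMap).flip

variable {F H V}

theorem diagAct_tmul [IsCocomm F H] (h : H) (x : ExteriorAlgebra F V) :
    diagAct F H V (h ⊗ₜ x) = diagAlgHom F H V x h := rfl

theorem diagAct_tmul_ι [IsCocomm F H] (h : H) (v : V) :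
    diagAct F H V (h ⊗ₜ ExteriorAlgebra.ι F v) = ExteriorAlgebra.ι F (h • v) := by
  rw [diagAct_tmul, diagAlgHom, ExteriorAlgebra.lift_ι_apply]
  rfl

theorem diagAct_lTensor_convMul [IsCocomm F H] {C : Type*} [Ring C] [Bialgebra F C]
    (X Y : WithConv (C →ₗ[F] ExteriorAlgebra F V)) :
    toConv (diagAct F H V ∘ₗ (X * Y).ofConv.lTensor H) =
      toConv (diagAct F H V ∘ₗ X.ofConv.lTensor H) *
        toConv (diagAct F H V ∘ₗ Y.ofConv.lTensor H) := by
  apply WithConv.ext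
  ext h c
  simp only [TensorProduct.AlgebraTensorModule.curry_apply, LinearMap.restrictScalars_self,
    TensorProduct.curry_apply]
  rw [((ℛ F h).tmul (ℛ F c)).convMul_apply]
  change diagAct F H V (h ⊗ₜ (X * Y) c) = _
  rw [(ℛ F c).convMul_apply, diagAct_tmul, map_sum, ofConv_sum, LinearMap.sum_apply]
  simp only [map_mul, (ℛ F h).convMul_apply]
  rw [Finset.sum_comm, ← Finset.sum_product']
  rfl

theorem diagAct_lTensor_one [IsCocomm F H] {C : Type*} [Ring C] [Bialgebra F C] :
    toConv (diagAct F H V ∘ₗ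
      (1 : WithConv (C →ₗ[F] ExteriorAlgebra F V)).ofConv.lTensor H) =
        (1 : WithConv (H ⊗[F] C →ₗ[F] ExteriorAlgebra F V)) := by
  apply WithConv.ext
  ext h c
  change diagAct F H V (h ⊗ₜ algebraMap F _ (counit c)) = _
  rw [diagAct_tmul, AlgHom.commutes]
  change counit (R := F) c • algebraMap F (ExteriorAlgebra F V) (counit h) =
    algebraMap F (ExteriorAlgebra F V) (counit (R := F) (h ⊗ₜ[F] c))
  simp [Algebra.smul_def]

/-- Transport of `X : H ⊗ H → ΛV` along the diagonal action,
`h ⊗ k ↦ h₍₁₎ X(h₍₂₎ ⊗ k)`. -/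
noncomputable def twist [IsCocomm F H] (X : WithConv (H ⊗[F] H →ₗ[F] ExteriorAlgebra F V)) :
    WithConv (H ⊗[F] H →ₗ[F] ExteriorAlgebra F V) :=
  toConv ((diagAct F H V ∘ₗ X.ofConv.lTensor H) ∘ₗ
    ((Coalgebra.TensorProduct.assoc F F H H H : (H ⊗[F] H) ⊗[F] H →ₗc[F] H ⊗[F] (H ⊗[F] H)).comp
      (CoalgHom.rTensor H (comulCoalgHom F H))).toLinearMap)

theorem twist_mul [IsCocomm F H] (X Y : WithConv (H ⊗[F] H →ₗ[F] ExteriorAlgebra F V)) :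
    twist (X * Y) = twist X * twist Y := by
  have := congrArg ofConv (diagAct_lTensor_convMul (H := H) X Y)
  rw [ofConv_toConv] at this
  rw [twist, this, LinearMap.convMul_comp_coalgHom_distrib]
  rfl

theorem twist_one [IsCocomm F H] :
    twist (1 : WithConv (H ⊗[F] H →ₗ[F] ExteriorAlgebra F V)) = 1 := by
  have := congrArg ofConv (diagAct_lTensor_one (F := F) (H := H) (V := V) (C := H ⊗[F] H))
  rw [ofConv_toConv] at this
  rw [twist, this]
  apply WithConv.ext
  ext1
  ext h k
  exact congrArg (algebraMap F _) (LinearMap.congr_fun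
    ((Coalgebra.TensorProduct.assoc F F H H H : (H ⊗[F] H) ⊗[F] H →ₗc[F] H ⊗[F] (H ⊗[F] H)).comp
      (CoalgHom.rTensor H (comulCoalgHom F H))).counit_comp (h ⊗ₜ k))

theorem twist_apply [IsCocomm F H] (X : WithConv (H ⊗[F] H →ₗ[F] ExteriorAlgebra F V)) (h k : H) :
    twist X (h ⊗ₜ k) = ∑ i ∈ (ℛ F h).index,
      diagAct F H V ((ℛ F h).left i ⊗ₜ X ((ℛ F h).right i ⊗ₜ k)) := by
  change diagAct F H V (X.ofConv.lTensor H (Coalgebra.TensorProduct.assoc F F H H H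
    (comul h ⊗ₜ k))) = _
  rw [← (ℛ F h).eq]
  simp [TensorProduct.sum_tmul]

end DiagonalAction

section WedgePower

variable (F H V : Type*) [Field F] [Ring H] [HopfAlgebra F H]
  [AddCommGroup V] [Module F V] [Module H V] [IsScalarTower F H V]

/-- The map `h ↦ h ▷ v` into the exterior algebra. -/
noncomputable def trbConv (v : V) : WithConv (H →ₗ[F] ExteriorAlgebra F V) :=
  toConv (ExteriorAlgebra.ι F ∘ₗ (trb F H V).flip v)

/-- The map `h ⊗ k ↦ k ▷ S(h) v` into the exterior algebra. -/
noncomputable def trbAntipode (v : V) : WithConv (H ⊗[F] H →ₗ[F] ExteriorAlgebra F V) :=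
  toConv (TensorProduct.lift (((trb F H V).compr₂ (ExteriorAlgebra.ι F)).flip ∘ₗ
    (Algebra.lsmul F F V : H →ₐ[F] Module.End F V).toLinearMap.flip v ∘ₗ
      HopfAlgebra.antipode F (A := H)))

variable {F H V}

theorem trbConv_apply (v : V) (h : H) :
    trbConv F H V v h = ExteriorAlgebra.ι F (h • v - counit (R := F) h • v) := rfl

theorem trbAntipode_tmul (v : V) (h k : H) :
    trbAntipode F H V v (h ⊗ₜ k) = trbConv F H V (HopfAlgebra.antipode F h • v) k := rfl

theorem purify_comp_sweedlerWedge : ∀ (n : ℕ) (vs : Fin n → V),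
    purify F H V ∘ₗ sweedlerWedge F H V n vs =
      ((List.ofFn fun j => trbConv F H V (vs j)).prod).ofConv
  | 0, vs => by
    ext h
    change counit (R := F) h • (1 : ExteriorAlgebra F V) = algebraMap F _ (counit h)
    rw [Algebra.algebraMap_eq_smul_one]
  | n + 1, vs => by
    rw [List.ofFn_succ, List.prod_cons, ← toConv_ofConv (List.prod _),
      ← purify_comp_sweedlerWedge n]
    ext h
    have hp : ∀ (a : ExteriorAlgebra F V) (z : ExteriorAlgebra F V ⊗[F] H),
        purify F H V ((LinearMap.mul F _ a).rTensor H z) = a * purify F H V z := by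
      intro a z
      induction z with
      | zero => simp
      | add x y hx hy => simp only [map_add, hx, hy, mul_add]
      | tmul x y => simp [purify]
    rw [(ℛ F h).convMul_apply]
    simp only [LinearMap.comp_apply, sweedlerWedge]
    rw [← (ℛ F h).eq, map_sum, map_sum]
    exact Finset.sum_congr rfl fun i _ => hp _ _

theorem mem_Kp {i : ℕ} {h : H} :
    h ∈ Kp F H V i ↔ ∀ l : List V, l.length = i + 1 → (l.map (trbConv F H V)).prod h = 0 := by
  simp only [Kp, Submodule.mem_iInf, LinearMap.mem_ker, purify_comp_sweedlerWedge]
  refine ⟨fun hh l hl => ?_, fun hh vs => ?_⟩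
  · have hl' : List.ofFn (fun j : Fin (i + 1) => l.get (j.cast hl.symm)) = l :=
      List.ext_getElem (by simp only [List.length_ofFn, hl]) fun n _ _ => by
        simp only [List.getElem_ofFn, List.get_eq_getElem, Fin.val_cast]
    rw [← hl', List.map_ofFn]
    exact hh _
  · have := hh (List.ofFn vs) (List.length_ofFn)
    rwa [List.map_ofFn] at this

theorem trbConv_comp_adj [CharZero F] [IsCocomm F H] (v : V) :
    toConv ((trbConv F H V v).ofConv ∘ₗ (adjCoalgHom F H).toLinearMap) =
      twist (trbAntipode F H V v) := by
  apply WithConv.ext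
  ext h k
  change trbConv F H V v (adjCoalgHom F H (h ⊗ₜ k)) = twist (trbAntipode F H V v) (h ⊗ₜ k)
  rw [twist_apply, trbConv_apply]
  simp only [trbAntipode_tmul, trbConv_apply, diagAct_tmul_ι]
  rw [← map_sum]
  have hε : counit (R := F) (adjCoalgHom F H (h ⊗ₜ k)) = counit (R := F) k * counit (R := F) h :=
    LinearMap.congr_fun (adjCoalgHom F H).counit_comp (h ⊗ₜ k)
  have hadj : adjCoalgHom F H (h ⊗ₜ k) = ∑ i ∈ (ℛ F h).index,
      (ℛ F h).left i * k * HopfAlgebra.antipode F ((ℛ F h).right i) := by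
    rw [adjCoalgHom_tmul, adj, ← (ℛ F h).eq, map_sum]
    rfl
  congr 1
  rw [hε, hadj, mul_smul]
  simp only [smul_sub, Finset.sum_sub_distrib, Finset.sum_smul, mul_smul]
  congr 1
  have := congrArg (· • v) (HopfAlgebra.sum_mul_antipode_eq_smul (ℛ F h))
  simp only [Finset.sum_smul, mul_smul, smul_assoc, one_smul] at this
  rw [← this, Finset.smul_sum]
  exact Finset.sum_congr rfl fun i _ => smul_comm _ _ _

theorem prod_trbConv_comp_adj [CharZero F] [IsCocomm F H] : ∀ l : List V,
    toConv ((l.map (trbConv F H V)).prod.ofConv ∘ₗ (adjCoalgHom F H).toLinearMap) =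
      twist (l.map (trbAntipode F H V)).prod
  | [] => by
    rw [List.map_nil, List.map_nil, List.prod_nil, List.prod_nil, twist_one]
    apply WithConv.ext
    ext1
    ext h k
    exact congrArg (algebraMap F _) (LinearMap.congr_fun (adjCoalgHom F H).counit_comp (h ⊗ₜ k))
  | v :: l => by
    simp only [List.map_cons, List.prod_cons]
    rw [LinearMap.convMul_comp_coalgHom_distrib, toConv_ofConv, trbConv_comp_adj,
      prod_trbConv_comp_adj l, twist_mul]

theorem prod_trbAntipode_tmul_eq_zero {n : ℕ} {k : H}
    (hk : ∀ l : List V, l.length = n → (l.map (trbConv F H V)).prod k = 0)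
    (l : List V) (hl : l.length = n) (h : H) :
    (l.map (trbAntipode F H V)).prod (h ⊗ₜ k) = 0 := by
  suffices hspan : ∀ (l : List V) (h : H), ∃ X ∈ Submodule.span F
      {X : WithConv (H →ₗ[F] ExteriorAlgebra F V) |
        ∃ m : List V, m.length = l.length ∧ X = (m.map (trbConv F H V)).prod},
      ∀ k, (l.map (trbAntipode F H V)).prod (h ⊗ₜ k) = X k by
    obtain ⟨X, hX, hXk⟩ := hspan l h
    rw [hXk]
    clear hXk
    induction hX using Submodule.span_induction with
    | mem X hX =>
      obtain ⟨m, hm, rfl⟩ := hX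
      exact hk m (hm.trans hl)
    | zero => rfl
    | add X Y _ _ hX hY => rw [ofConv_add, LinearMap.add_apply, hX, hY, add_zero]
    | smul c X _ hX => rw [ofConv_smul, LinearMap.smul_apply, hX, smul_zero]
  intro l
  induction l with
  | nil =>
    intro h
    refine ⟨counit (R := F) h • (1 : WithConv (H →ₗ[F] ExteriorAlgebra F V)),
      Submodule.smul_mem _ _ (Submodule.subset_span ⟨[], rfl, rfl⟩), fun k => ?_⟩
    change algebraMap F (ExteriorAlgebra F V) (counit (R := F) k * counit (R := F) h) =
      counit (R := F) h • algebraMap F (ExteriorAlgebra F V) (counit k)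
    rw [map_mul, ← Algebra.commutes, Algebra.smul_def]
  | cons v l ih =>
    intro h
    choose X hX hXk using ih
    refine ⟨∑ i ∈ (ℛ F h).index,
      trbConv F H V (HopfAlgebra.antipode F ((ℛ F h).left i) • v) * X ((ℛ F h).right i),
      Submodule.sum_mem _ fun i _ => ?_, fun k => ?_⟩
    · have := Submodule.mul_mem_mul (Submodule.mem_span_singleton_self (R := F)
        (trbConv F H V (HopfAlgebra.antipode F ((ℛ F h).left i) • v))) (hX ((ℛ F h).right i))
      rw [Submodule.span_mul_span] at this
      refine Submodule.span_mono ?_ this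
      rintro _ ⟨_, rfl, _, ⟨m, hm, rfl⟩, rfl⟩
      exact ⟨(HopfAlgebra.antipode F ((ℛ F h).left i) • v) :: m, by simp [hm], by simp⟩
    · rw [List.map_cons, List.prod_cons, ((ℛ F h).tmul (ℛ F k)).convMul_apply, ofConv_sum,
        LinearMap.sum_apply]
      simp only [(ℛ F k).convMul_apply]
      rw [← Finset.sum_product']
      refine Finset.sum_congr rfl fun x _ => ?_
      rw [← hXk]
      rfl

theorem adjCoalgHom_tmul_mem_Kp [CharZero F] [IsCocomm F H] {i : ℕ} {k : H}
    (hk : k ∈ Kp F H V i) (h : H) :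
    adjCoalgHom F H (h ⊗ₜ k) ∈ Kp F H V i := by
  rw [mem_Kp] at hk ⊢
  intro l hl
  refine (congrArg (fun X => X.ofConv (h ⊗ₜ[F] k)) (prod_trbConv_comp_adj (H := H) l)).trans ?_
  change twist (F := F) _ (h ⊗ₜ[F] k) = 0
  rw [twist_apply]
  refine Finset.sum_eq_zero fun j _ => ?_
  rw [prod_trbAntipode_tmul_eq_zero hk l hl, TensorProduct.tmul_zero, map_zero]

theorem adjCoalgHom_tmul_mem_K [CharZero F] [IsCocomm F H] {i : ℕ} {k : H}
    (hk : k ∈ K F H V i) (h : H) :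
    adjCoalgHom F H (h ⊗ₜ k) ∈ K F H V i := by
  obtain ⟨z, hz⟩ := hk
  have hmem : ∀ (z : Kp F H V i ⊗[F] H) (a b : H),
      TensorProduct.map (adjCoalgHom F H).toLinearMap (adjCoalgHom F H).toLinearMap
        (TensorProduct.AlgebraTensorModule.tensorTensorTensorComm F F F F H H H H
          ((a ⊗ₜ b) ⊗ₜ TensorProduct.map (Kp F H V i).subtype LinearMap.id z)) ∈
        LinearMap.range (TensorProduct.map (Kp F H V i).subtype (LinearMap.id (M := H))) := by
    intro z a b
    induction z with
    | zero => simp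
    | add x y hx hy =>
      simp only [map_add, TensorProduct.tmul_add]
      exact Submodule.add_mem _ hx hy
    | tmul x y =>
      exact ⟨⟨_, adjCoalgHom_tmul_mem_Kp x.2 a⟩ ⊗ₜ adjCoalgHom F H (b ⊗ₜ y), rfl⟩
  rw [K, Submodule.mem_comap, ← CoalgHomClass.map_comp_comul_apply, TensorProduct.comul_tmul,
    ← hz, ← (ℛ F h).eq, TensorProduct.sum_tmul, map_sum, map_sum]
  exact Submodule.sum_mem _ fun j _ => hmem z _ _

end WedgePower

/-- For every `i ≥ 0`, `K_i` is a submodule of `H` under the adjoint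
action: for `h ∈ H` and `k ∈ K_i`, the element `h₍₁₎ k S(h₍₂₎)` lies in `K_i`. -/
theorem stmt_4 (F H V : Type*) [Field F] [CharZero F] [Ring H] [HopfAlgebra F H]
    -- cocommutativity of `H`
    (hcc : ∀ h : H, (TensorProduct.comm F H H) (Coalgebra.comul h) = Coalgebra.comul h)
    [AddCommGroup V] [Module F V] [Module H V] [IsScalarTower F H V]
    [Module.Finite F V] :
    ∀ (i : ℕ) (h k : H), k ∈ K F H V i → adj F H h k ∈ K F H V i := by
  have : IsCocomm F H := ⟨LinearMap.ext hcc⟩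
  intro i h k hk
  rw [← adjCoalgHom_tmul]
  exact adjCoalgHom_tmul_mem_K hk h
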